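/- Let σ and μ be absolutely continuous probability measures on ℝⁿ with finite second moments, let P = [θ₁, …, θₙ] ∈ O(n), and let T ∈ 𝔖(P) be a P-compatible map with ∫ ‖T(x)‖² dσ(x) < ∞. Then Σᵢ₌₁ⁿ W₂²((T_♯σ)^{θᵢ}, μ^{θᵢ}) = ∫ ‖T(x) − T_{σ,μ;P}(x)‖² dσ(x). -/

import Mathlib

open MeasureTheory Filter
open scoped ENNReal RealInnerProductSpace BigOperators Topology

noncomputable section

namespace SliceMatching

/-- `ℝⁿ` with its Euclidean structure. -/
abbrev Rn (n : ℕ) := EuclideanSpace ℝ (Fin n)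

/-- The cumulative distribution function of a measure on `ℝ`. -/
def cdf (ν : Measure ℝ) (t : ℝ) : ℝ := (ν (Set.Iic t)).toReal

/-- The quantile function (pseudo-inverse of the CDF) of a measure on `ℝ`. -/
def quantile (ρ : Measure ℝ) (p : ℝ) : ℝ := sInf {t : ℝ | p ≤ cdf ρ t}

/-- The one-dimensional optimal transport map `T_ν^ρ = F_ρ⁻¹ ∘ F_ν`. -/
def otMap1d (ν ρ : Measure ℝ) (t : ℝ) : ℝ := quantile ρ (cdf ν t)

/-- The slice `σ^θ`: pushforward of `σ` under the projection `x ↦ ⟪x, θ⟫`. -/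
def slice {n : ℕ} (σ : Measure (Rn n)) (θ : Rn n) : Measure ℝ :=
  σ.map (fun x => ⟪x, θ⟫)

/-- The matrix-slice matching map `T_{σ,μ;P}`, where `P ∈ O(n)` has columns `θ 0, …, θ (n-1)`:
`T_{σ,μ;P}(x) = ∑ i, T_{σ^{θ i}}^{μ^{θ i}}(⟪x, θ i⟫) • θ i`. -/
def smMap {n : ℕ} (σ μ : Measure (Rn n)) (θ : Fin n → Rn n) (x : Rn n) : Rn n :=
  ∑ i, otMap1d (slice σ (θ i)) (slice μ (θ i)) ⟪x, θ i⟫ • θ i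

/-- The squared quadratic Wasserstein distance: the infimum of `∫ ‖x - y‖²` over all
couplings of `σ` and `μ`. -/
def W2sq {α : Type*} [MeasurableSpace α] [NormedAddCommGroup α] (σ μ : Measure α) : ℝ :=
  (⨅ (π : Measure (α × α)) (_ : π.map Prod.fst = σ ∧ π.map Prod.snd = μ),
    ∫⁻ p, ENNReal.ofReal (‖p.1 - p.2‖ ^ 2) ∂π).toReal

/-- The quadratic Wasserstein distance `W₂`. -/
def W2 {α : Type*} [MeasurableSpace α] [NormedAddCommGroup α] (σ μ : Measure α) : ℝ :=
  Real.sqrt (W2sq σ μ)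

lemma measurableSet_le_and_lt {α : Type*} [MeasurableSpace α] {a b c d : α → ℝ}
    (ha : Measurable a) (hb : Measurable b) (hc : Measurable c) (hd : Measurable d) :
    MeasurableSet {x | a x ≤ b x ∧ c x < d x} := by
  rw [Set.ofPred_and]
  exact (measurableSet_le ha hb).inter (measurableSet_lt hc hd)

/-- The squared distance on the line as an integral of measures of quadrants. -/
lemma lintegral_norm_sub_sq (π : Measure (ℝ × ℝ)) [SFinite π] :
    ∫⁻ z, ENNReal.ofReal (‖z.1 - z.2‖ ^ 2) ∂π =
      ∫⁻ p : ℝ × ℝ, (π {z | z.1 ≤ min p.1 p.2 ∧ max p.1 p.2 < z.2} +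
        π {z | z.2 ≤ min p.1 p.2 ∧ max p.1 p.2 < z.1}) := by
  have hD₁ : MeasurableSet {q : (ℝ × ℝ) × (ℝ × ℝ) |
      q.1.1 ≤ min q.2.1 q.2.2 ∧ max q.2.1 q.2.2 < q.1.2} :=
    measurableSet_le_and_lt (by fun_prop) (by fun_prop) (by fun_prop) (by fun_prop)
  have hD₂ : MeasurableSet {q : (ℝ × ℝ) × (ℝ × ℝ) |
      q.1.2 ≤ min q.2.1 q.2.2 ∧ max q.2.1 q.2.2 < q.1.1} :=
    measurableSet_le_and_lt (by fun_prop) (by fun_prop) (by fun_prop) (by fun_prop)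
  have h₁ := (Measure.prod_apply (μ := π) (ν := volume) hD₁).symm.trans
    (Measure.prod_apply_symm hD₁)
  have h₂ := (Measure.prod_apply (μ := π) (ν := volume) hD₂).symm.trans
    (Measure.prod_apply_symm hD₂)
  have hsq (x y : ℝ) : {p : ℝ × ℝ | x ≤ min p.1 p.2 ∧ max p.1 p.2 < y} =
      Set.Ico x y ×ˢ Set.Ico x y := by
    ext p
    simp only [Set.mem_ofPred_eq, le_min_iff, max_lt_iff, Set.mem_prod, Set.mem_Ico]
    tauto
  have hz (z : ℝ × ℝ) : ENNReal.ofReal (‖z.1 - z.2‖ ^ 2) =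
      volume {p : ℝ × ℝ | z.1 ≤ min p.1 p.2 ∧ max p.1 p.2 < z.2} +
        volume {p : ℝ × ℝ | z.2 ≤ min p.1 p.2 ∧ max p.1 p.2 < z.1} := by
    rw [hsq, hsq, Measure.volume_eq_prod, Measure.prod_prod, Measure.prod_prod,
      Real.volume_Ico, Real.volume_Ico, Real.norm_eq_abs, sq_abs]
    rcases le_total z.1 z.2 with h | h
    · rw [ENNReal.ofReal_of_nonpos (sub_nonpos.2 h), zero_mul, add_zero,
        ← ENNReal.ofReal_mul (sub_nonneg.2 h)]
      congr 1; ring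
    · rw [ENNReal.ofReal_of_nonpos (sub_nonpos.2 h), zero_mul, zero_add,
        ← ENNReal.ofReal_mul (sub_nonneg.2 h)]
      congr 1; ring
  simp_rw [hz]
  refine (lintegral_add_left (measurable_measure_prodMk_left hD₁) _).trans ?_
  refine Eq.trans ?_ (lintegral_add_left (measurable_measure_prodMk_right hD₁) _).symm
  exact congrArg₂ (· + ·) h₁ h₂

/-- Sublevel sets of two functions that are monotone on a common conull set are nested. -/
lemma measure_le_and_lt_le_sub {ν : Measure ℝ} [IsFiniteMeasure ν] {g S : ℝ → ℝ} {I : Set ℝ}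
    (hI : ν Iᶜ = 0) (hg : MonotoneOn g I) (hS : MonotoneOn S I)
    (hSm : AEMeasurable S ν) (s t : ℝ) :
    ν {x | g x ≤ s ∧ t < S x} ≤ ν {x | g x ≤ s} - ν {x | S x ≤ t} := by
  have hIae : ∀ᵐ x ∂ν, x ∈ I := hI
  by_cases hAB : ∃ a ∈ I, g a ≤ s ∧ t < S a
  · obtain ⟨a, haI, hga, hSa⟩ := hAB
    have hsub : ∀ b ∈ I, S b ≤ t → g b ≤ s := by
      intro b hbI hSb
      rcases le_total a b with h | h
      · exact absurd (hS haI hbI h) (by linarith)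
      · exact (hg hbI haI h).trans hga
    refine ENNReal.le_sub_of_add_le_right (measure_ne_top _ _) ?_
    have hm : NullMeasurableSet {x | S x ≤ t} ν := nullMeasurableSet_le hSm aemeasurable_const
    have hdisj : Disjoint {x | g x ≤ s ∧ t < S x} {x | S x ≤ t} := by
      rw [Set.disjoint_left]
      exact fun x hx hx' => absurd hx.2 (not_lt.2 hx')
    rw [← measure_union₀ hm hdisj.aedisjoint]
    refine measure_mono_ae ?_
    filter_upwards [hIae] with x hx h
    exact h.elim (fun h => h.1) (hsub x hx)
  · push Not at hAB
    refine le_of_eq_of_le ?_ zero_le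
    rw [measure_eq_zero_iff_ae_notMem]
    filter_upwards [hIae] with x hx h
    exact absurd h.2 (not_lt.2 (hAB x hx h.1))

/-- The comonotone coupling is optimal for the quadratic cost on the line. -/
lemma W2sq_map_map_of_monotoneOn {ν : Measure ℝ} [IsProbabilityMeasure ν] {g S : ℝ → ℝ}
    {I : Set ℝ} (hI : ν Iᶜ = 0) (hg : MonotoneOn g I) (hS : MonotoneOn S I)
    (hgm : AEMeasurable g ν) (hSm : AEMeasurable S ν) :
    W2sq (ν.map g) (ν.map S) = (∫⁻ x, ENNReal.ofReal (‖g x - S x‖ ^ 2) ∂ν).toReal := by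
  have hgS : AEMeasurable (fun x => (g x, S x)) ν := hgm.prodMk hSm
  have hcost : ∫⁻ x, ENNReal.ofReal (‖g x - S x‖ ^ 2) ∂ν =
      ∫⁻ z, ENNReal.ofReal (‖z.1 - z.2‖ ^ 2) ∂(ν.map fun x => (g x, S x)) := by
    rw [lintegral_map' (by fun_prop) hgS]
  unfold W2sq
  congr 1
  apply le_antisymm
  · rw [hcost]
    refine iInf₂_le _ ⟨?_, ?_⟩
    · rw [AEMeasurable.map_map_of_aemeasurable measurable_fst.aemeasurable hgS]
      rfl
    · rw [AEMeasurable.map_map_of_aemeasurable measurable_snd.aemeasurable hgS]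
      rfl
  · refine le_iInf₂ fun π hπ => ?_
    obtain ⟨h₁, h₂⟩ := hπ
    have : IsFiniteMeasure π := by
      refine ⟨?_⟩
      have h := congrArg (fun m => m Set.univ) h₁
      simp only [Measure.map_apply measurable_fst MeasurableSet.univ, Set.preimage_univ] at h
      rw [h]
      exact measure_lt_top _ _
    have hg' (s : ℝ) : ν {x | g x ≤ s} = π {z | z.1 ≤ s} := by
      have := congrArg (fun m => m (Set.Iic s)) h₁
      simp only [Measure.map_apply measurable_fst measurableSet_Iic,
        Measure.map_apply_of_aemeasurable hgm measurableSet_Iic] at this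
      exact this.symm
    have hS' (s : ℝ) : ν {x | S x ≤ s} = π {z | z.2 ≤ s} := by
      have := congrArg (fun m => m (Set.Iic s)) h₂
      simp only [Measure.map_apply measurable_snd measurableSet_Iic,
        Measure.map_apply_of_aemeasurable hSm measurableSet_Iic] at this
      exact this.symm
    rw [hcost, lintegral_norm_sub_sq, lintegral_norm_sub_sq]
    refine lintegral_mono fun p => add_le_add ?_ ?_
    · rw [Measure.map_apply_of_aemeasurable hgS
        (measurableSet_le_and_lt (by fun_prop) (by fun_prop) (by fun_prop) (by fun_prop))]
      refine (measure_le_and_lt_le_sub hI hg hS hSm _ _).trans ?_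
      rw [hg', hS']
      refine le_measure_sdiff.trans (measure_mono fun z hz => ⟨hz.1, not_le.1 hz.2⟩)
    · rw [Measure.map_apply_of_aemeasurable hgS
        (measurableSet_le_and_lt (by fun_prop) (by fun_prop) (by fun_prop) (by fun_prop))]
      refine (measure_le_and_lt_le_sub hI hS hg hgm _ _).trans ?_
      rw [hg', hS']
      refine le_measure_sdiff.trans (measure_mono fun z hz => ⟨hz.1, not_le.1 hz.2⟩)

lemma cdf_eq_cdf (ν : Measure ℝ) [IsProbabilityMeasure ν] (t : ℝ) :
    cdf ν t = ProbabilityTheory.cdf ν t := by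
  rw [ProbabilityTheory.cdf_eq_real]; rfl

lemma monotone_cdf (ν : Measure ℝ) [IsProbabilityMeasure ν] : Monotone (cdf ν) := by
  intro a b h
  simpa only [cdf_eq_cdf] using ProbabilityTheory.monotone_cdf ν h

lemma cdf_nonneg (ν : Measure ℝ) (t : ℝ) : 0 ≤ cdf ν t := ENNReal.toReal_nonneg

lemma ofReal_cdf (ν : Measure ℝ) [IsProbabilityMeasure ν] (t : ℝ) :
    ENNReal.ofReal (cdf ν t) = ν (Set.Iic t) :=
  ENNReal.ofReal_toReal (measure_ne_top _ _)

lemma tendsto_cdf_atBot (ν : Measure ℝ) [IsProbabilityMeasure ν] :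
    Tendsto (cdf ν) atBot (𝓝 0) := by
  simpa only [funext (cdf_eq_cdf ν)] using ProbabilityTheory.tendsto_cdf_atBot ν

lemma tendsto_cdf_atTop (ν : Measure ℝ) [IsProbabilityMeasure ν] :
    Tendsto (cdf ν) atTop (𝓝 1) := by
  simpa only [funext (cdf_eq_cdf ν)] using ProbabilityTheory.tendsto_cdf_atTop ν

lemma continuousWithinAt_cdf (ν : Measure ℝ) [IsProbabilityMeasure ν] (t : ℝ) :
    ContinuousWithinAt (cdf ν) (Set.Ici t) t := by
  simpa only [funext (cdf_eq_cdf ν)] using (ProbabilityTheory.cdf ν).right_continuous t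

/-- The Galois connection between the quantile function and the CDF. -/
lemma quantile_le_iff (ρ : Measure ℝ) [IsProbabilityMeasure ρ] {p : ℝ} (h₀ : 0 < p) (h₁ : p < 1)
    (y : ℝ) : quantile ρ p ≤ y ↔ p ≤ cdf ρ y := by
  have hbdd : BddBelow {t | p ≤ cdf ρ t} := by
    obtain ⟨b, hb⟩ := ((tendsto_cdf_atBot ρ).eventually (gt_mem_nhds h₀)).exists
    refine ⟨b, fun t ht => ?_⟩
    by_contra! h
    exact absurd (ht.trans (monotone_cdf ρ h.le)) (not_le.2 hb)
  have hne : {t | p ≤ cdf ρ t}.Nonempty := by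
    obtain ⟨b, hb⟩ := ((tendsto_cdf_atTop ρ).eventually (lt_mem_nhds h₁)).exists
    exact ⟨b, hb.le⟩
  refine ⟨fun h => ?_, fun h => csInf_le hbdd h⟩
  have hy : ∀ z ∈ Set.Ioi y, p ≤ cdf ρ z := by
    intro z hz
    obtain ⟨t, ht, htz⟩ := exists_lt_of_csInf_lt hne (h.trans_lt hz)
    exact le_trans ht (monotone_cdf ρ htz.le)
  refine ge_of_tendsto ((continuousWithinAt_cdf ρ y).mono_left
    (nhdsWithin_mono _ Set.Ioi_subset_Ici_self)) ?_
  exact eventually_nhdsWithin_of_forall hy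

/-- The CDF of an atomless measure is uniformly distributed. -/
lemma measure_cdf_le (ν : Measure ℝ) [IsProbabilityMeasure ν] [NullSingletonClass ν] {p : ℝ}
    (h₀ : 0 ≤ p) (h₁ : p ≤ 1) : ν {t | cdf ν t ≤ p} = ENNReal.ofReal p := by
  rcases h₁.eq_or_lt with rfl | h₁
  · have : {t | cdf ν t ≤ 1} = Set.univ := by
      refine Set.eq_univ_of_forall fun t => ?_
      rw [Set.mem_ofPred_eq, cdf_eq_cdf]
      exact ProbabilityTheory.cdf_le_one ν t
    simp [this]
  rcases Set.eq_empty_or_nonempty {t | cdf ν t ≤ p} with he | hne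
  · have hp : p ≤ 0 := by
      refine ge_of_tendsto' (tendsto_cdf_atBot ν) fun t => ?_
      by_contra! h
      exact Set.eq_empty_iff_forall_notMem.1 he t h.le
    rw [he, measure_empty, ENNReal.ofReal_of_nonpos hp]
  have hbdd : BddAbove {t | cdf ν t ≤ p} := by
    obtain ⟨b, hb⟩ := ((tendsto_cdf_atTop ν).eventually (lt_mem_nhds h₁)).exists
    refine ⟨b, fun t ht => ?_⟩
    by_contra! h
    exact absurd ((monotone_cdf ν h.le).trans ht) (not_le.2 hb)
  set c := sSup {t | cdf ν t ≤ p}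
  have hge : p ≤ cdf ν c := by
    refine ge_of_tendsto ((continuousWithinAt_cdf ν c).mono_left
      (nhdsWithin_mono _ Set.Ioi_subset_Ici_self)) ?_
    refine eventually_nhdsWithin_of_forall fun z hz => ?_
    by_contra! h
    exact absurd (le_csSup hbdd h.le) (not_le.2 hz)
  have hIio : ∀ t < c, cdf ν t ≤ p := by
    intro t ht
    obtain ⟨s, hs, hts⟩ := exists_lt_of_lt_csSup hne ht
    exact (monotone_cdf ν hts.le).trans hs
  have hsub : {t | cdf ν t ≤ p} ⊆ Set.Iic c := fun t ht => le_csSup hbdd ht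
  have hae : ν {t | cdf ν t ≤ p} = ν (Set.Iic c) := by
    refine le_antisymm (measure_mono hsub) ?_
    rw [← measure_congr (Iio_ae_eq_Iic (μ := ν))]
    exact measure_mono hIio
  have hle : cdf ν c ≤ p := by
    obtain ⟨u, hu_mono, huc, hu⟩ := exists_seq_strictMono_tendsto c
    have hU : ⋃ k, Set.Iic (u k) = Set.Iio c := by
      ext x
      simp only [Set.mem_iUnion, Set.mem_Iic, Set.mem_Iio]
      refine ⟨fun ⟨k, hk⟩ => hk.trans_lt (huc k), fun hx => ?_⟩
      obtain ⟨k, hk⟩ := (hu.eventually (lt_mem_nhds hx)).exists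
      exact ⟨k, hk.le⟩
    have hc' : ν (Set.Iic c) ≤ ENNReal.ofReal p := by
      rw [← measure_congr (Iio_ae_eq_Iic (μ := ν)), ← hU, Monotone.measure_iUnion
        fun a b hab => Set.Iic_subset_Iic.2 (hu_mono.monotone hab)]
      refine iSup_le fun k => ?_
      rw [← ofReal_cdf]
      exact ENNReal.ofReal_le_ofReal (hIio _ (huc k))
    exact ENNReal.toReal_le_of_le_ofReal h₀ hc'
  rw [hae, ← ofReal_cdf, le_antisymm hle hge]

/-- Almost everywhere, the CDF of an atomless measure lies strictly between `0` and `1`. -/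
lemma ae_cdf_mem_Ioo (ν : Measure ℝ) [IsProbabilityMeasure ν] [NullSingletonClass ν] :
    ∀ᵐ t ∂ν, cdf ν t ∈ Set.Ioo 0 1 := by
  have h₀ : ∀ᵐ t ∂ν, 0 < cdf ν t := by
    rw [ae_iff]
    simpa using measure_cdf_le ν le_rfl zero_le_one
  have h₁ : ∀ᵐ t ∂ν, cdf ν t < 1 := by
    have hm : MeasurableSet {t | cdf ν t < 1} :=
      measurableSet_lt (monotone_cdf ν).measurable measurable_const
    refine (mem_ae_iff_prob_eq_one hm).2 (le_antisymm prob_le_one ?_)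
    refine le_of_forall_lt_imp_le_of_dense fun c hc => ?_
    have hc' : c.toReal < 1 := ENNReal.toReal_lt_of_lt_ofReal (by simpa using hc)
    rw [← ENNReal.ofReal_toReal hc.ne_top, ← measure_cdf_le ν ENNReal.toReal_nonneg hc'.le]
    exact measure_mono fun t ht => lt_of_le_of_lt ht hc'
  filter_upwards [h₀, h₁] with t h h' using ⟨h, h'⟩

lemma monotoneOn_otMap1d (ν ρ : Measure ℝ) [IsProbabilityMeasure ν] [IsProbabilityMeasure ρ] :
    MonotoneOn (otMap1d ν ρ) {t | cdf ν t ∈ Set.Ioo 0 1} := by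
  intro a ha b hb hab
  rw [otMap1d, quantile_le_iff ρ ha.1 ha.2]
  exact (monotone_cdf ν hab).trans ((quantile_le_iff ρ hb.1 hb.2 _).1 le_rfl)

lemma aemeasurable_otMap1d (ν ρ : Measure ℝ) [IsProbabilityMeasure ν] [NullSingletonClass ν]
    [IsProbabilityMeasure ρ] : AEMeasurable (otMap1d ν ρ) ν := by
  have hm : MeasurableSet {t | cdf ν t ∈ Set.Ioo 0 1} :=
    (monotone_cdf ν).measurable measurableSet_Ioo
  have h := aemeasurable_restrict_of_monotoneOn (μ := ν) hm (monotoneOn_otMap1d ν ρ)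
  rwa [Measure.restrict_eq_self_of_ae_mem (s := {t | cdf ν t ∈ Set.Ioo 0 1})
    (ae_cdf_mem_Ioo ν)] at h

lemma map_otMap1d (ν ρ : Measure ℝ) [IsProbabilityMeasure ν] [NullSingletonClass ν]
    [IsProbabilityMeasure ρ] : ν.map (otMap1d ν ρ) = ρ := by
  have hm := aemeasurable_otMap1d ν ρ
  have := Measure.isProbabilityMeasure_map hm
  refine Measure.ext_of_Iic _ _ fun y => ?_
  rw [Measure.map_apply_of_aemeasurable hm measurableSet_Iic]
  have h₁ : cdf ρ y ≤ 1 := by rw [cdf_eq_cdf]; exact ProbabilityTheory.cdf_le_one ρ y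
  rw [← ofReal_cdf, ← measure_cdf_le ν (cdf_nonneg ρ y) h₁]
  refine measure_congr ?_
  filter_upwards [ae_cdf_mem_Ioo ν] with t ht
  exact propext (quantile_le_iff ρ ht.1 ht.2 y)

lemma nullSingletonClass_slice {n : ℕ} {σ : Measure (Rn n)} (hσ : σ ≪ volume) {θ : Rn n} (hθ : θ ≠ 0) :
    NullSingletonClass (slice σ θ) := by
  refine ⟨fun c => ?_⟩
  have hm : Measurable fun x : Rn n => ⟪x, θ⟫ := by fun_prop
  rw [slice, Measure.map_apply hm (measurableSet_singleton c)]
  apply hσ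
  have hsurj : Function.Surjective ((innerSL ℝ θ : Rn n →L[ℝ] ℝ) : Rn n →ₗ[ℝ] ℝ) :=
    LinearMap.surjective (by
      intro h
      exact hθ (inner_self_eq_zero.1 (LinearMap.congr_fun h θ)))
  obtain ⟨k, -, hk⟩ := LinearMap.exists_map_addHaar_eq_smul_addHaar
    ((innerSL ℝ θ : Rn n →L[ℝ] ℝ) : Rn n →ₗ[ℝ] ℝ) volume volume hsurj
  have h := congrArg (fun m => m {c}) hk
  simp only [Measure.smul_apply, measure_singleton, smul_zero] at h
  have hL : ⇑((innerSL ℝ θ : Rn n →L[ℝ] ℝ) : Rn n →ₗ[ℝ] ℝ) = fun x : Rn n => ⟪x, θ⟫ :=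
    funext fun x => real_inner_comm x θ
  rwa [hL, Measure.map_apply hm (measurableSet_singleton c)] at h

/-- For a `P`-compatible map `T`, the sum of the sliced squared Wasserstein
distances between the slices of `T_♯σ` and those of `μ` equals `‖T - T_{σ,μ;P}‖²_σ`. -/
theorem stmt6 {n : ℕ}
    (σ μ : Measure (Rn n)) [IsProbabilityMeasure σ] [IsProbabilityMeasure μ]
    (hσac : σ ≪ volume) (hμac : μ ≪ volume)
    (hσ2 : Integrable (fun x => ‖x‖ ^ 2) σ) (hμ2 : Integrable (fun y => ‖y‖ ^ 2) μ)
    (θ : Fin n → Rn n) (hθ : Orthonormal ℝ θ)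
    (f : Fin n → ℝ → ℝ) (hf : ∀ i, Monotone (f i))
    (T : Rn n → Rn n) (hT : ∀ x, T x = ∑ i, f i ⟪x, θ i⟫ • θ i)
    (hT2 : Integrable (fun x => ‖T x‖ ^ 2) σ) :
    ∑ i, W2sq (slice (σ.map T) (θ i)) (slice μ (θ i)) =
      ∫ x, ‖T x - smMap σ μ θ x‖ ^ 2 ∂σ := by
  have hTm : Measurable T := by
    have : T = fun x => ∑ i, f i ⟪x, θ i⟫ • θ i := funext hT
    rw [this]
    refine Finset.measurable_sum _ fun i _ => ?_
    exact ((hf i).measurable.comp (by fun_prop)).smul_const _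
  have hp (i : Fin n) : Measurable fun x : Rn n => ⟪x, θ i⟫ := by fun_prop
  have hν (i : Fin n) : IsProbabilityMeasure (slice σ (θ i)) :=
    Measure.isProbabilityMeasure_map (hp i).aemeasurable
  have hρ (i : Fin n) : IsProbabilityMeasure (slice μ (θ i)) :=
    Measure.isProbabilityMeasure_map (hp i).aemeasurable
  have hν' (i : Fin n) : NullSingletonClass (slice σ (θ i)) := nullSingletonClass_slice hσac (hθ.ne_zero i)
  have hTi (i : Fin n) (x : Rn n) : ⟪T x, θ i⟫ = f i ⟪x, θ i⟫ := by
    rw [hT, hθ.inner_left_fintype]; rfl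
  have hslice (i : Fin n) : slice (σ.map T) (θ i) = (slice σ (θ i)).map (f i) := by
    rw [slice, slice, Measure.map_map (hp i) hTm, Measure.map_map (hf i).measurable (hp i)]
    congr 1
    exact funext (hTi i)
  set S : Fin n → ℝ → ℝ := fun i => otMap1d (slice σ (θ i)) (slice μ (θ i))
  have hSm (i : Fin n) : AEMeasurable (S i) (slice σ (θ i)) := aemeasurable_otMap1d _ _
  have hproj (i : Fin n) (x : Rn n) : ⟪x, θ i⟫ ^ 2 ≤ ‖x‖ ^ 2 := by
    rw [sq_le_sq, abs_norm]
    simpa [hθ.norm_eq_one i] using abs_real_inner_le_norm x (θ i)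
  have hfL (i : Fin n) : MemLp (fun x => f i ⟪x, θ i⟫) 2 σ := by
    have hm : Measurable fun x => f i ⟪x, θ i⟫ := (hf i).measurable.comp (hp i)
    rw [memLp_two_iff_integrable_sq hm.aestronglyMeasurable]
    refine hT2.mono' (hm.pow_const 2).aestronglyMeasurable (ae_of_all _ fun x => ?_)
    rw [Real.norm_eq_abs, abs_sq, ← hTi]
    exact hproj i _
  have hSL' (i : Fin n) : MemLp (S i) 2 (slice σ (θ i)) := by
    have hid : MemLp id 2 ((slice σ (θ i)).map (S i)) := by
      rw [map_otMap1d, slice, memLp_map_measure_iff aestronglyMeasurable_id (hp i).aemeasurable,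
        Function.id_comp, memLp_two_iff_integrable_sq (hp i).aestronglyMeasurable]
      refine hμ2.mono' ((hp i).pow_const 2).aestronglyMeasurable (ae_of_all _ fun x => ?_)
      rw [Real.norm_eq_abs, abs_of_nonneg (sq_nonneg _)]
      exact hproj i x
    exact (memLp_map_measure_iff aestronglyMeasurable_id (hSm i)).1 hid
  have hSL (i : Fin n) : MemLp (fun x => S i ⟪x, θ i⟫) 2 σ :=
    (hSL' i).comp_of_map (hp i).aemeasurable
  have hint (i : Fin n) : Integrable (fun x => (f i ⟪x, θ i⟫ - S i ⟪x, θ i⟫) ^ 2) σ :=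
    ((hfL i).sub (hSL i)).integrable_sq
  have hW (i : Fin n) : W2sq (slice (σ.map T) (θ i)) (slice μ (θ i)) =
      ∫ x, (f i ⟪x, θ i⟫ - S i ⟪x, θ i⟫) ^ 2 ∂σ := by
    have hopt := W2sq_map_map_of_monotoneOn (ν := slice σ (θ i)) (ae_cdf_mem_Ioo (slice σ (θ i)))
      ((hf i).monotoneOn _) (monotoneOn_otMap1d _ (slice μ (θ i)))
      (hf i).measurable.aemeasurable (hSm i)
    rw [map_otMap1d] at hopt
    have hm : AEMeasurable (fun t => ENNReal.ofReal (‖f i t - S i t‖ ^ 2)) (slice σ (θ i)) :=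
      (((hf i).measurable.aemeasurable.sub (hSm i)).norm.pow_const 2).ennreal_ofReal
    have hmap := lintegral_map' hm (hp i).aemeasurable
    rw [hslice, hopt]
    refine (congrArg ENNReal.toReal hmap).trans ?_
    rw [integral_eq_lintegral_of_nonneg_ae (ae_of_all _ fun x => sq_nonneg _) (hint i).aestronglyMeasurable]
    simp_rw [Real.norm_eq_abs, sq_abs]
  have hnorm (x : Rn n) : ‖T x - smMap σ μ θ x‖ ^ 2 =
      ∑ i, (f i ⟪x, θ i⟫ - S i ⟪x, θ i⟫) ^ 2 := by
    rw [hT, smMap, ← Finset.sum_sub_distrib]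
    simp_rw [← sub_smul]
    rw [← real_inner_self_eq_norm_sq, hθ.inner_sum]
    exact Finset.sum_congr rfl fun i _ => (sq _).symm
  simp_rw [hW, hnorm]
  exact (integral_finsetSum _ fun i _ => hint i).symm

end SliceMatching
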